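/- Let λ(k) = (1 − √(1+4k²))/2 for k ∈ ℝ. For every γ with 0 ≤ γ ≤ 1 and every m ∈ ℕ there exists a constant C > 0 such that for all x > 0, every integrable function f : ℝ → ℂ with ∫_ℝ |z|^γ·|f(z)| dz < ∞, and every y ∈ ℝ, | ∫_ℝ (2πik)^m · e^{λ(k)·x} · ( 𝓕f(k) − 𝓕f(0) ) · e^{2πiky} dk | ≤ C · ⟨x⟩^{(1+m+γ)/2} · x^{−(1+m+γ)} · ∫_ℝ |z|^γ·|f(z)| dz. -/

import Mathlib

open MeasureTheory Real

/-- `⟨x⟩ = √(1+x²)`. -/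
noncomputable def jap (x : ℝ) : ℝ := Real.sqrt (1 + x ^ 2)

/-- `λ(k) = (1 − √(1+4k²))/2`. -/
noncomputable def lamR (k : ℝ) : ℝ := (1 - Real.sqrt (1 + 4 * k ^ 2)) / 2

/-- The Fourier transform `𝓕f(k) = ∫_ℝ e^{−2πikz} f(z) dz`. -/
noncomputable def fourierT (f : ℝ → ℂ) (k : ℝ) : ℂ :=
  ∫ z : ℝ, Complex.exp ((-2) * π * k * z * Complex.I) * f z

lemma aux_abs {p s : ℝ} (hp : 0 < p) (hs : 0 ≤ s) : ∃ c : ℝ, 0 < c ∧ ∀ x : ℝ, 0 < x →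
    Integrable (fun k : ℝ => |k| ^ s * Real.exp (-(x / 2) * |k| ^ p)) ∧
    ∫ k : ℝ, |k| ^ s * Real.exp (-(x / 2) * |k| ^ p) = c * x ^ (-(s + 1) / p) := by
  have hG : 0 < Real.Gamma ((s + 1) / p) := Real.Gamma_pos_of_pos (by positivity)
  have h2 : (0 : ℝ) < (1 / 2) ^ (-(s + 1) / p) := Real.rpow_pos_of_pos (by norm_num) _
  refine ⟨2 * ((1 / 2) ^ (-(s + 1) / p) * (1 / p) * Real.Gamma ((s + 1) / p)), by positivity,
    fun x hx => ?_⟩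
  have key : ∫ k : ℝ, |k| ^ s * Real.exp (-(x / 2) * |k| ^ p) =
      2 * ((1 / 2) ^ (-(s + 1) / p) * (1 / p) * Real.Gamma ((s + 1) / p)) *
        x ^ (-(s + 1) / p) := by
    rw [integral_comp_abs (f := fun k => k ^ s * Real.exp (-(x / 2) * k ^ p)),
      integral_rpow_mul_exp_neg_mul_rpow hp (by linarith) (by positivity),
      show x / 2 = (1 / 2) * x by ring, Real.mul_rpow (by norm_num) hx.le]
    ring
  refine ⟨Integrable.of_integral_ne_zero ?_, key⟩
  rw [key]
  have := Real.rpow_pos_of_pos hx (-(s + 1) / p)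
  positivity

lemma lamR_le (k : ℝ) : lamR k ≤ -(1 / 2) * |k| ^ 2 ∨ lamR k ≤ -(1 / 2) * |k| := by
  unfold lamR
  have h0 := abs_nonneg k
  rw [← sq_abs k]
  set a := |k|
  rcases le_total a 1 with h | h
  · left
    have : 1 + a ^ 2 ≤ √(1 + 4 * a ^ 2) := by
      apply Real.le_sqrt_of_sq_le
      have h2 : a ^ 2 ≤ 1 := by nlinarith
      nlinarith [mul_nonneg (sq_nonneg a) (sub_nonneg.2 h2)]
    linarith
  · right
    have : 1 + a ≤ √(1 + 4 * a ^ 2) := by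
      apply Real.le_sqrt_of_sq_le
      nlinarith
    linarith

lemma exp_lamR_le (k x : ℝ) (hx : 0 < x) : Real.exp (lamR k * x) ≤
    Real.exp (-(x / 2) * |k| ^ (2 : ℝ)) + Real.exp (-(x / 2) * |k| ^ (1 : ℝ)) := by
  rw [Real.rpow_one, Real.rpow_two]
  rcases lamR_le k with h | h
  · have := mul_le_mul_of_nonneg_right h hx.le
    have h1 : Real.exp (lamR k * x) ≤ Real.exp (-(x / 2) * |k| ^ 2) :=
      Real.exp_le_exp.2 (by linarith)
    linarith [Real.exp_pos (-(x / 2) * |k|)]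
  · have := mul_le_mul_of_nonneg_right h hx.le
    have h1 : Real.exp (lamR k * x) ≤ Real.exp (-(x / 2) * |k|) :=
      Real.exp_le_exp.2 (by linarith)
    linarith [Real.exp_pos (-(x / 2) * |k| ^ 2)]

lemma min_rpow_le {γ t : ℝ} (hγ0 : 0 ≤ γ) (hγ1 : γ ≤ 1) (ht : 0 ≤ t) :
    min 1 t ≤ t ^ γ := by
  rcases le_total t 1 with h | h
  · rcases ht.eq_or_lt with h0 | h0
    · rw [← h0]
      exact (min_le_right _ _).trans (Real.rpow_nonneg le_rfl _)
    · refine (min_le_right _ _).trans ?_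
      simpa using Real.rpow_le_rpow_of_exponent_ge h0 h hγ1
  · exact (min_le_left _ _).trans (Real.one_le_rpow h hγ0)

lemma exp_diff {γ : ℝ} (hγ0 : 0 ≤ γ) (hγ1 : γ ≤ 1) (k z : ℝ) :
    ‖Complex.exp ((-2) * π * k * z * Complex.I) - 1‖ ≤ 2 * π ^ γ * |k| ^ γ * |z| ^ γ := by
  have e : ((-2) * π * k * z * Complex.I : ℂ) = Complex.I * ((-2 * π * k * z : ℝ) : ℂ) := by
    push_cast; ring
  rw [e, Complex.norm_exp_I_mul_ofReal_sub_one, norm_mul, Real.norm_eq_abs, Real.norm_eq_abs]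
  have h1 : |Real.sin (-2 * π * k * z / 2)| ≤ min 1 (π * |k| * |z|) := by
    refine le_min (Real.abs_sin_le_one _) ?_
    refine Real.abs_sin_le_abs.trans ?_
    rw [show -2 * π * k * z / 2 = -(π * k * z) by ring, abs_neg, abs_mul, abs_mul,
      abs_of_pos Real.pi_pos]
  have h2 := h1.trans (min_rpow_le hγ0 hγ1 (by positivity))
  rw [Real.mul_rpow (by positivity) (by positivity),
    Real.mul_rpow (by positivity) (by positivity)] at h2
  rw [abs_of_pos (by norm_num : (0:ℝ) < 2)]
  linarith

lemma fourier_diff {γ : ℝ} (hγ0 : 0 ≤ γ) (hγ1 : γ ≤ 1) (f : ℝ → ℂ) (hf : Integrable f)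
    (hg : Integrable (fun z : ℝ => |z| ^ γ * ‖f z‖)) (k : ℝ) :
    ‖fourierT f k - fourierT f 0‖ ≤ 2 * π ^ γ * |k| ^ γ * ∫ z : ℝ, |z| ^ γ * ‖f z‖ := by
  have h0 : fourierT f 0 = ∫ z, f z := by simp [fourierT]
  have hi : Integrable (fun z : ℝ => Complex.exp ((-2) * π * k * z * Complex.I) * f z) := by
    refine hf.bdd_mul (c := 1) (by fun_prop) (Filter.Eventually.of_forall fun z => ?_)
    have e : ((-2) * π * k * z * Complex.I : ℂ) = ((-2 * π * k * z : ℝ) : ℂ) * Complex.I := by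
      push_cast; ring
    rw [e, Complex.norm_exp_ofReal_mul_I]
  rw [h0, fourierT, ← integral_sub hi hf, ← integral_const_mul]
  refine norm_integral_le_of_norm_le (hg.const_mul _) (Filter.Eventually.of_forall fun z => ?_)
  have := mul_le_mul_of_nonneg_right (exp_diff hγ0 hγ1 k z) (norm_nonneg (f z))
  rw [← norm_mul, sub_mul, one_mul] at this
  linarith

/-- Let `λ(k) = (1−√(1+4k²))/2`. For every `0 ≤ γ ≤ 1` and `m ∈ ℕ`
there is `C > 0` such that for all `x > 0`, every integrable `f : ℝ → ℂ` with
`∫ |z|^γ ‖f z‖ dz < ∞`, and every `y ∈ ℝ`,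
`‖∫ (2πik)^m e^{λ(k)x} (𝓕f(k) − 𝓕f(0)) e^{2πiky} dk‖ ≤
  C ⟨x⟩^{(1+m+γ)/2} x^{−(1+m+γ)} ∫ |z|^γ ‖f z‖ dz`. -/
theorem stmt19 (γ : ℝ) (hγ0 : 0 ≤ γ) (hγ1 : γ ≤ 1) (m : ℕ) :
    ∃ C : ℝ, 0 < C ∧ ∀ x : ℝ, 0 < x →
      ∀ f : ℝ → ℂ, Integrable f (volume : Measure ℝ) →
        Integrable (fun z : ℝ => |z| ^ γ * ‖f z‖) (volume : Measure ℝ) →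
        ∀ y : ℝ,
          ‖∫ k : ℝ, (2 * (π : ℂ) * Complex.I * (k : ℂ)) ^ m *
              ((Real.exp (lamR k * x) : ℝ) : ℂ) * (fourierT f k - fourierT f 0) *
              Complex.exp (2 * π * k * y * Complex.I)‖ ≤
            C * jap x ^ ((1 + (m : ℝ) + γ) / 2) * x ^ (-(1 + (m : ℝ) + γ)) *
              ∫ z : ℝ, |z| ^ γ * ‖f z‖ := by
  have hs : 0 ≤ (m : ℝ) + γ := by positivity
  obtain ⟨c2, hc2, H2⟩ := aux_abs (p := 2) (by norm_num) hs
  obtain ⟨c1, hc1, H1⟩ := aux_abs (p := 1) (by norm_num) hs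
  have hpi := Real.pi_pos
  have hpg : 0 < π ^ γ := Real.rpow_pos_of_pos hpi _
  refine ⟨(2 * π) ^ m * (2 * π ^ γ) * (c2 + c1), by positivity, fun x hx f hf hg y => ?_⟩
  obtain ⟨I2, E2⟩ := H2 x hx
  obtain ⟨I1, E1⟩ := H1 x hx
  set M := ∫ z : ℝ, |z| ^ γ * ‖f z‖ with hM
  have hM0 : 0 ≤ M := integral_nonneg fun z => by positivity
  have hb := norm_integral_le_of_norm_le
    (f := fun k : ℝ => (2 * (π : ℂ) * Complex.I * (k : ℂ)) ^ m *
              ((Real.exp (lamR k * x) : ℝ) : ℂ) * (fourierT f k - fourierT f 0) *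
              Complex.exp (2 * π * k * y * Complex.I))
    ((I2.add I1).const_mul ((2 * π) ^ m * (2 * π ^ γ) * M))
    (Filter.Eventually.of_forall fun k => by
      have e : (2 * π * k * y * Complex.I : ℂ) = ((2 * π * k * y : ℝ) : ℂ) * Complex.I := by
        push_cast; ring
      have n1 : ‖(2 * (π : ℂ) * Complex.I * (k : ℂ)) ^ m‖ = (2 * π) ^ m * |k| ^ m := by
        simp [abs_of_pos hpi, mul_pow]
      have n2 : |k| ^ ((m : ℝ) + γ) = |k| ^ m * |k| ^ γ := by
        rw [Real.rpow_add_of_nonneg (abs_nonneg k) (by positivity) hγ0, Real.rpow_natCast]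
      rw [norm_mul, norm_mul, norm_mul, e, Complex.norm_exp_ofReal_mul_I, mul_one, n1,
        Complex.norm_real, Real.norm_eq_abs, abs_of_pos (Real.exp_pos _)]
      simp only [Pi.add_apply]
      rw [n2]
      calc _ ≤ (2 * π) ^ m * |k| ^ m * (Real.exp (-(x / 2) * |k| ^ (2 : ℝ)) +
            Real.exp (-(x / 2) * |k| ^ (1 : ℝ))) * (2 * π ^ γ * |k| ^ γ * M) := by
            gcongr
            · exact exp_lamR_le k x hx
            · exact fourier_diff hγ0 hγ1 f hf hg k
        _ = _ := by ring)
  refine hb.trans ?_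
  rw [integral_const_mul, integral_add' I2 I1, E2, E1]
  have hj1 : 1 ≤ jap x := by
    apply Real.le_sqrt_of_sq_le; nlinarith
  have hjx : x ≤ jap x := by
    apply Real.le_sqrt_of_sq_le; nlinarith
  set a := 1 + (m : ℝ) + γ with ha
  have ha0 : 0 ≤ a / 2 := by positivity
  have b2 : x ^ (-((m : ℝ) + γ + 1) / 2) ≤ jap x ^ (a / 2) * x ^ (-a) := by
    calc x ^ (-((m : ℝ) + γ + 1) / 2) = x ^ (a / 2) * x ^ (-a) := by
          rw [← Real.rpow_add hx]; congr 1; rw [ha]; ring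
      _ ≤ _ := by gcongr
  have b1 : x ^ (-((m : ℝ) + γ + 1) / 1) ≤ jap x ^ (a / 2) * x ^ (-a) := by
    calc x ^ (-((m : ℝ) + γ + 1) / 1) = 1 * x ^ (-a) := by
          rw [one_mul]; congr 1; rw [ha]; ring
      _ ≤ _ := by
          gcongr
          exact Real.one_le_rpow hj1 ha0
  calc _ ≤ (2 * π) ^ m * (2 * π ^ γ) * M * (c2 * (jap x ^ (a / 2) * x ^ (-a)) +
        c1 * (jap x ^ (a / 2) * x ^ (-a))) := by gcongr
    _ = _ := by ring
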